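/- Let t ≥ 4 be a rational number and let G be a t-tough, non-Hamiltonian graph on n ≥ 3 vertices with a Hamilton path P = v_1 ⋯ v_n from x = v_1 to y = v_n, where x and y are nonadjacent and deg(x) + deg(y) ≥ n − t. Then every crossing-gap of P contains at least two vertices; that is, there is no index i ∈ [3, n−2] such that v_i is adjacent to neither x nor y while v_{i−1} is adjacent to y and v_{i+1} is adjacent to x. Moreover, if q ≥ 1 denotes the number of common neighbors of x and y, then P has at least q − 1 distinct crossing-gaps. -/

import Mathlib

/-- A graph `G` is `t`-tough if `|S| ≥ t · c(G − S)` for every vertex subset `S`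
whose removal leaves at least two connected components. -/
def SimpleGraph.Tough {V : Type*} [Fintype V] (t : ℚ) (G : SimpleGraph V) : Prop :=
  ∀ S : Finset V,
    2 ≤ Nat.card ((G.induce ((↑S : Set V)ᶜ)).ConnectedComponent) →
    t * (Nat.card ((G.induce ((↑S : Set V)ᶜ)).ConnectedComponent) : ℚ) ≤ (S.card : ℚ)

/-- Given a Hamilton path `v 1, …, v n` of `G` with ends `x = v 1` and `y = v n`,
the pair `(i, j)` determines a crossing-gap `{v i, …, v j}`: an interval-gap
(a maximal run of vertices adjacent to neither `x` nor `y`, with both boundary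
vertices adjacent to `x` or `y`) whose left boundary `v (i−1)` is adjacent to `y`
and whose right boundary `v (j+1)` is adjacent to `x`. -/
def IsCrossingGap {V : Type*} (G : SimpleGraph V) (v : ℕ → V) (n i j : ℕ) : Prop :=
  3 ≤ i ∧ i ≤ j ∧ j ≤ n - 2 ∧
  (∀ k, i ≤ k → k ≤ j → ¬ G.Adj (v k) (v 1) ∧ ¬ G.Adj (v k) (v n)) ∧
  G.Adj (v (i - 1)) (v n) ∧ G.Adj (v (j + 1)) (v 1)

/-- Deleting the neighbourhood of a nonempty independent set `I` isolates each of its vertices; a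
further vertex `u` lies in yet another component. -/
lemma SimpleGraph.Tough.mul_card_add_one_le {V : Type*} [Fintype V] [DecidableEq V]
    {G : SimpleGraph V} [DecidableRel G.Adj] {t : ℚ} (htough : G.Tough t) (ht : 0 ≤ t)
    {I : Finset V} (hI : I.Nonempty) (hind : ∀ a ∈ I, ∀ b ∈ I, ¬ G.Adj a b) {u : V} (hu : u ∉ I)
    (hadj : ∀ a ∈ I, ¬ G.Adj a u) :
    t * (I.card + 1) ≤ (I.biUnion fun a ↦ G.neighborFinset a).card := by
  set S := I.biUnion fun a ↦ G.neighborFinset a with hS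
  set H := G.induce ((↑S : Set V)ᶜ)
  have hmem : ∀ a ∈ insert u I, a ∈ ((↑S : Set V)ᶜ) := by
    intro a ha haS
    simp only [hS, Finset.mem_coe, Finset.mem_biUnion, mem_neighborFinset] at haS
    obtain ⟨b, hb, hba⟩ := haS
    rcases Finset.mem_insert.mp ha with rfl | ha
    · exact hadj b hb hba
    · exact hind b hb a ha hba
  have hiso : ∀ a b : ↥((↑S : Set V)ᶜ), a.1 ∈ I → H.Reachable a b → a = b := by
    rintro a b ha ⟨p⟩
    cases p with
    | nil => rfl
    | cons hac p =>
      rename_i c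
      refine absurd ?_ c.2
      simp only [hS, Finset.mem_coe, Finset.mem_biUnion, mem_neighborFinset]
      exact ⟨a, ha, hac⟩
  let f : ↥(insert u I) → H.ConnectedComponent :=
    fun a ↦ H.connectedComponentMk ⟨a, hmem a a.2⟩
  have hf : f.Injective := by
    rintro ⟨a, ha⟩ ⟨b, hb⟩ hab
    have hr := ConnectedComponent.exact hab
    rw [Subtype.mk.injEq]
    rcases Finset.mem_insert.mp ha with rfl | ha'
    · rcases Finset.mem_insert.mp hb with rfl | hb'
      · rfl
      · exact (congrArg Subtype.val (hiso _ _ hb' hr.symm)).symm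
    · exact congrArg Subtype.val (hiso _ _ ha' hr)
  have hcard : I.card + 1 ≤ Nat.card H.ConnectedComponent := by
    have := Nat.card_le_card_of_injective f hf
    rwa [Nat.card_eq_fintype_card, Fintype.card_coe, Finset.card_insert_of_notMem hu] at this
  have hpos := hI.card_pos
  refine le_trans ?_ (htough S (by lia))
  gcongr
  exact_mod_cast hcard


lemma SimpleGraph.Adj.exists_walk_cons {V : Type*} {G : SimpleGraph V} {a b c : V}
    (h : G.Adj a b) (p : G.Walk b c) :
    ∃ q : G.Walk a c, q.length = p.length + 1 ∧ ∀ u ∈ p.support, u ∈ q.support :=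
  ⟨.cons h p, by simp, fun u hu ↦ by simp [hu]⟩

/-- A closed walk of length `|V|` obtained by closing up a spanning walk is a Hamiltonian cycle. -/
lemma SimpleGraph.isHamiltonian_of_spanning_walk {V : Type*} [Fintype V] [DecidableEq V]
    {G : SimpleGraph V} {a b : V} (p : G.Walk a b) (hcard : 3 ≤ Fintype.card V)
    (hlen : p.length + 1 = Fintype.card V) (hmem : ∀ u, u ∈ p.support) (hadj : G.Adj b a) :
    G.IsHamiltonian := by
  have hnodup : p.support.Nodup := by
    rw [← Multiset.coe_nodup, ← Multiset.toFinset_card_eq_card_iff_nodup]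
    have : (p.support : Multiset V).toFinset = Finset.univ := by
      ext u; simp [hmem u]
    rw [this, Finset.card_univ, Multiset.coe_card, Walk.length_support, hlen]
  refine fun _ ↦ ⟨b, Walk.cons hadj p, ?_⟩
  rw [Walk.isHamiltonianCycle_iff_isCycle_and_length_eq, Walk.isCycle_iff_isPath_tail_and_le_length]
  refine ⟨⟨?_, ?_⟩, ?_⟩
  · simpa using Walk.IsPath.mk' hnodup
  · rw [Walk.length_cons]; lia
  · rw [Walk.length_cons]; lia

/-- `v 1, …, v n` enumerates the vertices of a non-Hamiltonian graph `G` along a Hamilton path with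
nonadjacent ends. -/
structure IsNonHamiltonianPath {V : Type*} [Fintype V] [DecidableEq V] (G : SimpleGraph V)
    (v : ℕ → V) (n : ℕ) : Prop where
  card_eq : Fintype.card V = n
  three_le : 3 ≤ n
  not_isHamiltonian : ¬ G.IsHamiltonian
  bijOn : Set.BijOn v (Set.Icc 1 n) Set.univ
  adj_succ : ∀ i, 1 ≤ i → i < n → G.Adj (v i) (v (i + 1))
  not_adj_ends : ¬ G.Adj (v 1) (v n)

/-- The `i`-th vertex of the path alone forms a crossing-gap. -/
def IsSingletonGap {V : Type*} (G : SimpleGraph V) (v : ℕ → V) (n i : ℕ) : Prop :=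
  3 ≤ i ∧ i ≤ n - 2 ∧ ¬ G.Adj (v i) (v 1) ∧ ¬ G.Adj (v i) (v n) ∧
    G.Adj (v (i - 1)) (v n) ∧ G.Adj (v (i + 1)) (v 1)

open Classical in
/-- The indices at which both ends of the path miss the matching between predecessors of neighbours
of `v 1` and neighbours of `v n`. -/
noncomputable def unmatchedIndices {V : Type*} (G : SimpleGraph V) (v : ℕ → V) (n : ℕ) : Finset ℕ :=
  {k ∈ Finset.Icc 1 (n - 1) | ¬ G.Adj (v k) (v n) ∧ ¬ G.Adj (v (k + 1)) (v 1)}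

open Classical in
/-- The positions of the singleton crossing-gaps. -/
noncomputable def singletonGapIndices {V : Type*} (G : SimpleGraph V) (v : ℕ → V) (n : ℕ) :
    Finset ℕ :=
  {i ∈ Finset.Icc 3 (n - 2) | IsSingletonGap G v n i}

lemma mem_unmatchedIndices {V : Type*} {G : SimpleGraph V} {v : ℕ → V} {n k : ℕ} :
    k ∈ unmatchedIndices G v n ↔
      (1 ≤ k ∧ k ≤ n - 1) ∧ ¬ G.Adj (v k) (v n) ∧ ¬ G.Adj (v (k + 1)) (v 1) := by
  simp [unmatchedIndices]

lemma mem_singletonGapIndices {V : Type*} {G : SimpleGraph V} {v : ℕ → V} {n i : ℕ} :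
    i ∈ singletonGapIndices G v n ↔ IsSingletonGap G v n i := by
  simp only [singletonGapIndices, Finset.mem_filter, Finset.mem_Icc, and_iff_right_iff_imp]
  exact fun h ↦ ⟨h.1, h.2.1⟩

namespace IsNonHamiltonianPath

variable {V : Type*} [Fintype V] [DecidableEq V] {G : SimpleGraph V} {v : ℕ → V} {n : ℕ}

lemma exists_walk_of_le (h : IsNonHamiltonianPath G v n) {a b : ℕ} (ha : 1 ≤ a) (hab : a ≤ b)
    (hb : b ≤ n) :
    ∃ p : G.Walk (v a) (v b), p.length = b - a ∧ ∀ k, a ≤ k → k ≤ b → v k ∈ p.support := by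
  induction b, hab using Nat.le_induction with
  | base =>
    refine ⟨.nil, by simp, fun k h₁ h₂ ↦ ?_⟩
    simp [le_antisymm h₂ h₁]
  | succ b hab ih =>
    obtain ⟨p, hp, hs⟩ := ih (by lia)
    refine ⟨p.concat (h.adj_succ b (by lia) (by lia)), ?_, fun k h₁ h₂ ↦ ?_⟩
    · rw [SimpleGraph.Walk.length_concat]; lia
    · rw [SimpleGraph.Walk.support_concat]
      rcases h₂.eq_or_lt with rfl | h₂
      · simp
      · simp [hs k h₁ (by lia)]

lemma exists_walk (h : IsNonHamiltonianPath G v n) {a b : ℕ} (ha : 1 ≤ a ∧ a ≤ n)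
    (hb : 1 ≤ b ∧ b ≤ n) :
    ∃ p : G.Walk (v a) (v b), p.length = (b - a) + (a - b) ∧
      ∀ k, min a b ≤ k → k ≤ max a b → v k ∈ p.support := by
  rcases le_total a b with hab | hab
  · obtain ⟨p, hp, hs⟩ := h.exists_walk_of_le ha.1 hab hb.2
    exact ⟨p, by lia, fun k h₁ h₂ ↦ hs k (by lia) (by lia)⟩
  · obtain ⟨p, hp, hs⟩ := h.exists_walk_of_le hb.1 hab ha.2
    refine ⟨p.reverse, by rw [SimpleGraph.Walk.length_reverse]; lia, fun k h₁ h₂ ↦ ?_⟩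
    simpa using hs k (by lia) (by lia)

/-- Consecutive subpaths of the enumerated path, each traversed in either direction, form a walk. -/
lemma exists_walk_of_segments (h : IsNonHamiltonianPath G v n) (s : ℕ × ℕ) (l : List (ℕ × ℕ))
    (hbd : ∀ r ∈ s :: l, (1 ≤ r.1 ∧ r.1 ≤ n) ∧ (1 ≤ r.2 ∧ r.2 ≤ n))
    (hl : (s :: l).IsChain fun r r' ↦ G.Adj (v r.2) (v r'.1)) :
    ∃ p : G.Walk (v s.1) (v ((s :: l).getLast (by simp)).2),
      p.length + 1 = ((s :: l).map fun r ↦ (r.2 - r.1) + (r.1 - r.2) + 1).sum ∧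
      ∀ k, (∃ r ∈ s :: l, min r.1 r.2 ≤ k ∧ k ≤ max r.1 r.2) → v k ∈ p.support := by
  induction l generalizing s with
  | nil =>
    obtain ⟨p, hp, hs⟩ := h.exists_walk (hbd s (by simp)).1 (hbd s (by simp)).2
    exact ⟨p, by simp [hp], by simpa using hs⟩
  | cons s' l ih =>
    rw [List.isChain_cons_cons] at hl
    obtain ⟨p, hp, hs⟩ := h.exists_walk (hbd s (by simp)).1 (hbd s (by simp)).2
    obtain ⟨p', hp', hs'⟩ := ih s' (fun r hr ↦ hbd r (List.mem_cons_of_mem _ hr)) hl.2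
    obtain ⟨q, hq, hqs⟩ : ∃ q : G.Walk (v s.2) (v ((s :: s' :: l).getLast (by simp)).2),
        q.length = p'.length + 1 ∧ ∀ u ∈ p'.support, u ∈ q.support :=
      hl.1.exists_walk_cons p'
    refine ⟨p.append q, ?_, ?_⟩
    · rw [List.map_cons, List.sum_cons, ← hp', ← hp, SimpleGraph.Walk.length_append, hq]
      lia
    · rintro k ⟨r, hr, h₁, h₂⟩
      rw [SimpleGraph.Walk.mem_support_append_iff]
      rcases List.mem_cons.mp hr with rfl | hr
      · exact .inl (hs k h₁ h₂)
      · exact .inr (hqs _ (hs' k ⟨r, hr, h₁, h₂⟩))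

/-- Subpaths covering the path exactly once cannot be joined up to a cycle. -/
lemma not_adj_of_segments (h : IsNonHamiltonianPath G v n) (s : ℕ × ℕ) (l : List (ℕ × ℕ))
    (hbd : ∀ r ∈ s :: l, (1 ≤ r.1 ∧ r.1 ≤ n) ∧ (1 ≤ r.2 ∧ r.2 ≤ n))
    (hl : (s :: l).IsChain fun r r' ↦ G.Adj (v r.2) (v r'.1))
    (hsum : ((s :: l).map fun r ↦ (r.2 - r.1) + (r.1 - r.2) + 1).sum = n)
    (hcov : ∀ k, 1 ≤ k → k ≤ n → ∃ r ∈ s :: l, min r.1 r.2 ≤ k ∧ k ≤ max r.1 r.2) :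
    ¬ G.Adj (v ((s :: l).getLast (by simp)).2) (v s.1) := by
  intro hadj
  obtain ⟨p, hp, hs⟩ := h.exists_walk_of_segments s l hbd hl
  refine h.not_isHamiltonian (SimpleGraph.isHamiltonian_of_spanning_walk p ?_ ?_ (fun u ↦ ?_) hadj)
  · exact h.card_eq ▸ h.three_le
  · rw [hp, hsum, h.card_eq]
  · obtain ⟨k, hk, rfl⟩ := h.bijOn.surjOn (Set.mem_univ u)
    exact hs k (hcov k hk.1 hk.2)

lemma not_adj_succ (h : IsNonHamiltonianPath G v n) {j : ℕ} (hj : 1 ≤ j) (hjn : j < n)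
    (hy : G.Adj (v j) (v n)) : ¬ G.Adj (v (j + 1)) (v 1) := by
  refine h.not_adj_of_segments (1, j) [(n, j + 1)] ?_ ?_ ?_ ?_ <;> simp [*]
  all_goals lia

lemma not_adj_first_of_adj_left (h : IsNonHamiltonianPath G v n) {i j : ℕ}
    (hi : IsSingletonGap G v n i) (hj : 1 ≤ j) (hji : j < i) (hadj : G.Adj (v j) (v i)) :
    ¬ G.Adj (v (j + 1)) (v 1) := by
  obtain ⟨h3, hin, hx, hy, hy', hx'⟩ := hi
  rcases eq_or_ne (j + 1) i with rfl | hne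
  · exact hx
  refine h.not_adj_of_segments (1, j) [(i, n), (i - 1, j + 1)] ?_ ?_ ?_ ?_ <;>
    simp [*, hy'.symm]
  all_goals lia

lemma not_adj_last_of_adj_left (h : IsNonHamiltonianPath G v n) {i j : ℕ}
    (hi : IsSingletonGap G v n i) (hj : 1 ≤ j) (hji : j < i) (hadj : G.Adj (v j) (v i)) :
    ¬ G.Adj (v (j + 1)) (v n) := by
  obtain ⟨h3, hin, hx, hy, hy', hx'⟩ := hi
  intro hcon
  refine h.not_adj_of_segments (1, j) [(i, j + 1), (n, i + 1)] ?_ ?_ ?_ ?_ hx' <;> simp [*]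
  all_goals lia

lemma not_adj_first_of_adj_right (h : IsNonHamiltonianPath G v n) {i j : ℕ}
    (hi : IsSingletonGap G v n i) (hj : j ≤ n) (hij : i < j) (hadj : G.Adj (v j) (v i)) :
    ¬ G.Adj (v (j - 1)) (v 1) := by
  obtain ⟨h3, hin, hx, hy, hy', hx'⟩ := hi
  intro hcon
  refine h.not_adj_of_segments (n, j) [(i, j - 1), (1, i - 1)] ?_ ?_ ?_ ?_ hy' <;> simp [*]
  all_goals lia

lemma not_adj_last_of_adj_right (h : IsNonHamiltonianPath G v n) {i j : ℕ}
    (hi : IsSingletonGap G v n i) (hj : j ≤ n) (hij : i < j) (hadj : G.Adj (v j) (v i)) :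
    ¬ G.Adj (v (j - 1)) (v n) := by
  obtain ⟨h3, hin, hx, hy, hy', hx'⟩ := hi
  rcases eq_or_ne (j - 1) i with hne | hne
  · rwa [hne]
  refine h.not_adj_of_segments (n, j) [(i, 1), (i + 1, j - 1)] ?_ ?_ ?_ ?_ <;>
    simp [*, hx'.symm]
  all_goals lia

/-- A singleton crossing-gap is not adjacent to two consecutive vertices on one of its sides. -/
lemma not_adj_consecutive (h : IsNonHamiltonianPath G v n) {i j : ℕ}
    (hi : IsSingletonGap G v n i) (hj : 1 ≤ j) (hjn : j + 1 ≤ n)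
    (hadj : G.Adj (v j) (v i)) (hadj' : G.Adj (v (j + 1)) (v i)) : False := by
  obtain ⟨h3, hin, hx, hy, hy', hx'⟩ := hi
  have h₁ : j ≠ i := by rintro rfl; exact G.irrefl hadj
  have h₂ : j + 1 ≠ i := by rintro rfl; exact G.irrefl hadj'
  rcases h₁.lt_or_gt with hlt | hlt
  · refine h.not_adj_of_segments (1, j) [(i, i), (j + 1, i - 1), (n, i + 1)] ?_ ?_ ?_ ?_ hx' <;>
      simp [*, hadj'.symm]
    all_goals lia
  · refine h.not_adj_of_segments (1, i - 1) [(n, j + 1), (i, i), (j, i + 1)] ?_ ?_ ?_ ?_ hx' <;>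
      simp [*, hadj.symm]
    all_goals lia

lemma not_adj_of_isSingletonGap_of_lt (h : IsNonHamiltonianPath G v n) {i k : ℕ}
    (hi : IsSingletonGap G v n i) (hk : IsSingletonGap G v n k) (hik : i < k) :
    ¬ G.Adj (v i) (v k) := by
  obtain ⟨h3, hin, hx, hy, hy', hx'⟩ := hi
  obtain ⟨h3k, hkn, hxk, hyk, hyk', hxk'⟩ := hk
  have hne : k ≠ i + 1 := by rintro rfl; exact hxk hx'
  intro hadj
  refine h.not_adj_of_segments (1, i) [(k, n), (k - 1, i + 1)] ?_ ?_ ?_ ?_ hx' <;>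
    simp [*, hyk'.symm]
  all_goals lia

/-- Adjacencies of two singleton crossing-gaps to consecutive vertices between them cannot cross. -/
lemma not_adj_crossing (h : IsNonHamiltonianPath G v n) {i k m : ℕ}
    (hi : IsSingletonGap G v n i) (hk : IsSingletonGap G v n k) (him : i < m) (hmk : m + 1 < k)
    (hadj : G.Adj (v (m + 1)) (v i)) : ¬ G.Adj (v m) (v k) := by
  obtain ⟨h3, hin, hx, hy, hy', hx'⟩ := hi
  obtain ⟨h3k, hkn, hxk, hyk, hyk', hxk'⟩ := hk
  intro hcon
  refine h.not_adj_of_segments (1, i) [(m + 1, k - 1), (n, k), (m, i + 1)] ?_ ?_ ?_ ?_ hx' <;>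
    simp [*, hadj.symm, hcon.symm]
  all_goals omega

lemma card_filter_index (h : IsNonHamiltonianPath G v n) (p : V → Prop)
    [DecidablePred p] :
    ((Finset.Icc 1 n).filter fun k ↦ p (v k)).card = (Finset.univ.filter p).card := by
  refine Finset.card_bij (fun k _ ↦ v k) (fun k hk ↦ by simpa using (Finset.mem_filter.mp hk).2)
    (fun k hk k' hk' hkk' ↦ ?_) (fun u hu ↦ ?_)
  · simp only [Finset.mem_filter, Finset.mem_Icc] at hk hk'
    exact h.bijOn.injOn hk.1 hk'.1 hkk'
  · obtain ⟨k, hk, rfl⟩ := h.bijOn.surjOn (Set.mem_univ u)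
    exact ⟨k, by simpa using ⟨hk, by simpa using hu⟩, rfl⟩

lemma card_filter_adj [DecidableRel G.Adj] (h : IsNonHamiltonianPath G v n) (a : V) :
    ((Finset.Icc 1 n).filter fun k ↦ G.Adj (v k) a).card = G.degree a := by
  rw [h.card_filter_index (fun u ↦ G.Adj u a), ← SimpleGraph.card_neighborFinset_eq_degree,
    SimpleGraph.neighborFinset_eq_filter]
  simp only [SimpleGraph.adj_comm]

lemma degree_add_degree_add_card_unmatchedIndices [DecidableRel G.Adj]
    (h : IsNonHamiltonianPath G v n) :
    G.degree (v 1) + G.degree (v n) + (unmatchedIndices G v n).card = n - 1 := by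
  have h3 := h.three_le
  have hx : ((Finset.Icc 1 (n - 1)).filter fun k ↦ G.Adj (v (k + 1)) (v 1)).card =
      G.degree (v 1) := by
    rw [← h.card_filter_adj]
    refine Finset.card_bij (fun k _ ↦ k + 1) (fun k hk ↦ ?_) (by simp) (fun k hk ↦ ?_)
    · simp only [Finset.mem_filter, Finset.mem_Icc] at hk ⊢
      exact ⟨by lia, hk.2⟩
    · simp only [Finset.mem_filter, Finset.mem_Icc] at hk
      have hk1 : k ≠ 1 := by rintro rfl; exact G.irrefl hk.2
      have hk2 : k - 1 + 1 = k := by lia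
      refine ⟨k - 1, ?_, hk2⟩
      simp only [Finset.mem_filter, Finset.mem_Icc, hk2]
      exact ⟨by lia, hk.2⟩
  have hy : ((Finset.Icc 1 (n - 1)).filter fun k ↦ G.Adj (v k) (v n)).card =
      G.degree (v n) := by
    rw [← h.card_filter_adj]
    congr 1
    ext k
    simp only [Finset.mem_filter, Finset.mem_Icc]
    refine ⟨fun hk ↦ ⟨by lia, hk.2⟩, fun hk ↦ ⟨?_, hk.2⟩⟩
    have hkn : k ≠ n := by rintro rfl; exact G.irrefl hk.2
    lia
  rw [← hx, ← hy, ← Finset.card_union_of_disjoint, ← Finset.card_union_of_disjoint]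
  · trans (Finset.Icc 1 (n - 1)).card
    · congr 1
      ext k
      simp only [Finset.mem_union, Finset.mem_filter, mem_unmatchedIndices, Finset.mem_Icc]
      tauto
    · simp
  · rw [Finset.disjoint_left]
    intro k
    simp only [Finset.mem_union, Finset.mem_filter, mem_unmatchedIndices]
    tauto
  · rw [Finset.disjoint_left]
    intro k
    simp only [Finset.mem_filter, Finset.mem_Icc]
    rintro ⟨hk, hkx⟩ ⟨-, hky⟩
    exact h.not_adj_succ hk.1 (by lia) hky hkx

lemma mem_of_adj_left (h : IsNonHamiltonianPath G v n) {i j : ℕ} (hi : IsSingletonGap G v n i)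
    (hj : 1 ≤ j) (hji : j < i) (hadj : G.Adj (v j) (v i)) :
    j ∈ unmatchedIndices G v n ∨
      j + 1 ∈ unmatchedIndices G v n ∨ j + 1 ∈ singletonGapIndices G v n := by
  have hx := h.not_adj_first_of_adj_left hi hj hji hadj
  have hy := h.not_adj_last_of_adj_left hi hj hji hadj
  have hj1 : j ≠ 1 := by rintro rfl; exact hi.2.2.1 hadj.symm
  have hin := hi.2.1
  rw [mem_unmatchedIndices, mem_unmatchedIndices, mem_singletonGapIndices, IsSingletonGap,
    Nat.add_sub_cancel]
  have hb : (1 ≤ j ∧ j ≤ n - 1) ∧ (1 ≤ j + 1 ∧ j + 1 ≤ n - 1) ∧ 3 ≤ j + 1 ∧ j + 1 ≤ n - 2 := by lia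
  tauto

lemma mem_of_adj_right (h : IsNonHamiltonianPath G v n) {i j : ℕ} (hi : IsSingletonGap G v n i)
    (hj : j ≤ n) (hij : i < j) (hadj : G.Adj (v j) (v i)) :
    j - 1 ∈ unmatchedIndices G v n ∨
      j - 1 ∈ singletonGapIndices G v n ∨ j - 2 ∈ unmatchedIndices G v n := by
  have hx := h.not_adj_first_of_adj_right hi hj hij hadj
  have hy := h.not_adj_last_of_adj_right hi hj hij hadj
  have hjn : j ≠ n := by rintro rfl; exact hi.2.2.2.1 hadj.symm
  have hi3 := hi.1
  rw [mem_unmatchedIndices, mem_unmatchedIndices, mem_singletonGapIndices, IsSingletonGap,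
    show j - 1 + 1 = j by lia, show j - 2 + 1 = j - 1 by lia, show j - 1 - 1 = j - 2 by lia]
  have hb : (1 ≤ j - 1 ∧ j - 1 ≤ n - 1) ∧ (1 ≤ j - 2 ∧ j - 2 ≤ n - 1) ∧
      3 ≤ j - 1 ∧ j - 1 ≤ n - 2 := by lia
  tauto

lemma degree_le_of_isSingletonGap [DecidableRel G.Adj] (h : IsNonHamiltonianPath G v n) {i : ℕ}
    (hi : IsSingletonGap G v n i) :
    G.degree (v i) ≤ (singletonGapIndices G v n).card + (unmatchedIndices G v n).card + 1 := by
  set M := unmatchedIndices G v n with hM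
  set Z := singletonGapIndices G v n with hZ
  set J := (Finset.Icc 1 n).filter fun k ↦ G.Adj (v k) (v i) with hJ
  have hmem : ∀ {j}, j ∈ J ↔ (1 ≤ j ∧ j ≤ n) ∧ G.Adj (v j) (v i) := by simp [hJ]
  have hin := hi.2.1
  have hi3 := hi.1
  have hsucc : i + 1 ∈ J := hmem.mpr ⟨by lia, (h.adj_succ i (by lia) (by lia)).symm⟩
  have hcons : ∀ j ∈ J, j + 1 ∉ J := fun j hj hj' ↦
    h.not_adj_consecutive hi (hmem.mp hj).1.1 (hmem.mp hj').1.2 (hmem.mp hj).2 (hmem.mp hj').2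
  have hpred : i - 1 ∉ Z ∪ M := by
    rw [Finset.mem_union, hZ, hM, mem_singletonGapIndices, mem_unmatchedIndices]
    rintro (hz | hm)
    · exact hz.2.2.2.1 hi.2.2.2.2.1
    · exact hm.2.1 hi.2.2.2.2.1
  let f : ℕ → ℕ := fun j ↦
    if j < i then (if j ∈ M then j else j + 1) else (if j - 1 ∈ Z ∪ M then j - 1 else j - 2)
  have hcard : (J.erase (i + 1)).card ≤ (Z ∪ M).card := by
    refine Finset.card_le_card_of_injOn f (fun j hj ↦ ?_) (fun j hj j' hj' hjj' ↦ ?_)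
    · obtain ⟨hj1, hjJ⟩ := Finset.mem_erase.mp hj
      obtain ⟨hjn, hadj⟩ := hmem.mp hjJ
      have hne : j ≠ i := by rintro rfl; exact G.irrefl hadj
      rw [Finset.mem_coe]
      rcases hne.lt_or_gt with hlt | hlt
      · have := h.mem_of_adj_left hi hjn.1 hlt hadj
        simp only [f, if_pos hlt]
        split_ifs with hjM
        · exact Finset.mem_union_right _ hjM
        · rw [Finset.mem_union]; tauto
      · have := h.mem_of_adj_right hi hjn.2 hlt hadj
        simp only [f, if_neg hlt.not_gt]
        split_ifs with hjM
        · exact hjM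
        · rw [Finset.mem_union] at hjM ⊢; tauto
    · obtain ⟨hj1, hjJ⟩ := Finset.mem_erase.mp hj
      obtain ⟨hj1', hjJ'⟩ := Finset.mem_erase.mp hj'
      have hc := hcons j hjJ
      have hc' := hcons j' hjJ'
      have hci := hcons (i + 1) hsucc
      have hne : j ≠ i := by rintro rfl; exact G.irrefl (hmem.mp hjJ).2
      have hne' : j' ≠ i := by rintro rfl; exact G.irrefl (hmem.mp hjJ').2
      have hj2 : j ≠ i + 1 + 1 := by rintro rfl; exact hci hjJ
      have hj2' : j' ≠ i + 1 + 1 := by rintro rfl; exact hci hjJ'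
      have hk : j' ≠ j + 1 := by rintro rfl; exact hc hjJ'
      have hk' : j ≠ j' + 1 := by rintro rfl; exact hc' hjJ
      simp only [f] at hjj'
      split_ifs at hjj' <;> lia
  have hJcard : J.card = G.degree (v i) := h.card_filter_adj (v i)
  have hunion := Finset.card_union_le Z M
  have herase := Finset.card_erase_of_mem hsucc
  lia

lemma not_adj_of_isSingletonGap (h : IsNonHamiltonianPath G v n) {i k : ℕ}
    (hi : IsSingletonGap G v n i) (hk : IsSingletonGap G v n k) : ¬ G.Adj (v i) (v k) := by
  rcases lt_trichotomy i k with hik | rfl | hik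
  · exact h.not_adj_of_isSingletonGap_of_lt hi hk hik
  · exact G.irrefl
  · exact fun hadj ↦ h.not_adj_of_isSingletonGap_of_lt hk hi hik hadj.symm

lemma vertex_ne_of_isSingletonGap (h : IsNonHamiltonianPath G v n) {i : ℕ}
    (hi : IsSingletonGap G v n i) : v 1 ≠ v i := by
  intro heq
  have hi3 := hi.1
  have hin := hi.2.1
  have := h.bijOn.injOn (Set.mem_Icc.mpr ⟨le_rfl, by lia⟩) (Set.mem_Icc.mpr ⟨by lia, by lia⟩) heq
  lia

lemma card_biUnion_neighborFinset_le [DecidableRel G.Adj] (h : IsNonHamiltonianPath G v n) :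
    (((singletonGapIndices G v n).image v).biUnion fun a ↦ G.neighborFinset a).card ≤
      2 * (singletonGapIndices G v n).card + 3 * (unmatchedIndices G v n).card := by
  classical
  set M := unmatchedIndices G v n with hM
  set Z := singletonGapIndices G v n with hZ
  let f : ℕ → ℕ := fun m ↦
    if ∃ k, IsSingletonGap G v n k ∧ m < k ∧ G.Adj (v m) (v k) then m else m + 1
  set T := (Z.image (· - 1) ∪ Z.image (· + 1)) ∪ ((M.image (· - 1) ∪ M.image (· + 2)) ∪ M.image f)
    with hT
  have hsub : ((Z.image v).biUnion fun a ↦ G.neighborFinset a) ⊆ T.image v := by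
    intro u hu
    simp only [Finset.mem_biUnion, Finset.mem_image, SimpleGraph.mem_neighborFinset] at hu
    obtain ⟨_, ⟨i, hiZ, rfl⟩, hadj⟩ := hu
    obtain ⟨j, ⟨hj1, hjn⟩, rfl⟩ := h.bijOn.surjOn (Set.mem_univ u)
    have hi : IsSingletonGap G v n i := mem_singletonGapIndices.mp hiZ
    refine Finset.mem_image_of_mem v ?_
    have hne : j ≠ i := by rintro rfl; exact G.irrefl hadj
    simp only [hT, Finset.mem_union, Finset.mem_image]
    rcases hne.lt_or_gt with hlt | hlt
    · rcases h.mem_of_adj_left hi hj1 hlt hadj.symm with hm | hm | hm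
      · exact .inr (.inr ⟨j, hm, if_pos ⟨i, hi, hlt, hadj.symm⟩⟩)
      · exact .inr (.inl (.inl ⟨j + 1, hm, by lia⟩))
      · exact .inl (.inl ⟨j + 1, hm, by lia⟩)
    · rcases h.mem_of_adj_right hi hjn hlt hadj.symm with hm | hm | hm
      · refine .inr (.inr ⟨j - 1, hm, ?_⟩)
        have hm' := mem_unmatchedIndices.mp hm
        have hj : j - 1 + 1 = j := by lia
        rw [← hj] at hadj
        refine (if_neg ?_).trans hj
        rintro ⟨k, hk, hjk, hadjk⟩
        have hki : j - 1 ≠ i := by rintro rfl; exact hm'.2.2 hi.2.2.2.2.2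
        have hkj : k ≠ j := by rintro rfl; exact hm'.2.1 hk.2.2.2.2.1
        exact h.not_adj_crossing hi hk (by lia) (by lia) hadj.symm hadjk
      · exact .inl (.inr ⟨j - 1, hm, by lia⟩)
      · refine .inr (.inl (.inr ⟨j - 2, hm, ?_⟩))
        have := (mem_unmatchedIndices.mp hm).1
        lia
  have hcardT : T.card ≤ 2 * Z.card + 3 * M.card := by
    have h₁ := Finset.card_union_le (Z.image (· - 1)) (Z.image (· + 1))
    have h₂ := Finset.card_union_le (M.image (· - 1)) (M.image (· + 2))
    have h₃ := Finset.card_union_le (M.image (· - 1) ∪ M.image (· + 2)) (M.image f)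
    have h₄ := Finset.card_union_le (Z.image (· - 1) ∪ Z.image (· + 1))
      ((M.image (· - 1) ∪ M.image (· + 2)) ∪ M.image f)
    have h₅ := Finset.card_image_le (s := Z) (f := (· - 1))
    have h₆ := Finset.card_image_le (s := Z) (f := (· + 1))
    have h₇ := Finset.card_image_le (s := M) (f := (· - 1))
    have h₈ := Finset.card_image_le (s := M) (f := (· + 2))
    have h₉ := Finset.card_image_le (s := M) (f := f)
    lia
  exact (Finset.card_le_card hsub).trans (Finset.card_image_le.trans hcardT)

theorem not_isSingletonGap [DecidableRel G.Adj] (h : IsNonHamiltonianPath G v n) {t : ℚ}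
    (ht : 4 ≤ t) (htough : G.Tough t)
    (hdeg : (n : ℚ) - t ≤ (G.degree (v 1) : ℚ) + (G.degree (v n) : ℚ)) (i : ℕ) :
    ¬ IsSingletonGap G v n i := by
  intro hi
  set z := (singletonGapIndices G v n).card
  set μ := (unmatchedIndices G v n).card
  have hμt : (μ : ℚ) + 1 ≤ t := by
    have h₁ := h.degree_add_degree_add_card_unmatchedIndices
    have h₂ : G.degree (v 1) + G.degree (v n) + μ + 1 = n := by have := h.three_le; lia
    have h₃ : (G.degree (v 1) : ℚ) + G.degree (v n) + μ + 1 = n := mod_cast h₂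
    linarith
  have hzt : 2 * t ≤ (z : ℚ) + μ + 1 := by
    have h₁ := htough.mul_card_add_one_le (by linarith) (I := {v i}) (by simp)
      (by simp) (u := v 1) (by simpa using h.vertex_ne_of_isSingletonGap hi)
      (by simpa using hi.2.2.1)
    have h₂ : (G.degree (v i) : ℚ) ≤ z + μ + 1 := mod_cast h.degree_le_of_isSingletonGap hi
    rw [Finset.singleton_biUnion, SimpleGraph.card_neighborFinset_eq_degree,
      Finset.card_singleton] at h₁
    push_cast at h₁
    linarith
  have hN : t * ((z : ℚ) + 1) ≤ 2 * z + 3 * μ := by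
    have hinj : Set.InjOn v (singletonGapIndices G v n) := by
      refine h.bijOn.injOn.mono fun k hk ↦ ?_
      have hk := mem_singletonGapIndices.mp hk
      exact ⟨by have := hk.1; lia, by have := hk.2.1; lia⟩
    have h₁ := htough.mul_card_add_one_le (by linarith) (I := (singletonGapIndices G v n).image v)
      ((Finset.nonempty_of_ne_empty
        (Finset.ne_empty_of_mem (mem_singletonGapIndices.mpr hi))).image v)
      (fun a ha b hb ↦ by
        obtain ⟨k, hk, rfl⟩ := Finset.mem_image.mp ha
        obtain ⟨l, hl, rfl⟩ := Finset.mem_image.mp hb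
        exact h.not_adj_of_isSingletonGap (mem_singletonGapIndices.mp hk)
          (mem_singletonGapIndices.mp hl))
      (u := v 1)
      (fun ha ↦ by
        obtain ⟨k, hk, hk1⟩ := Finset.mem_image.mp ha
        exact h.vertex_ne_of_isSingletonGap (mem_singletonGapIndices.mp hk) hk1.symm)
      (fun a ha ↦ by
        obtain ⟨k, hk, rfl⟩ := Finset.mem_image.mp ha
        exact (mem_singletonGapIndices.mp hk).2.2.1)
    rw [Finset.card_image_of_injOn hinj] at h₁
    exact h₁.trans (mod_cast h.card_biUnion_neighborFinset_le)
  nlinarith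

/-- Between a common neighbour of the ends and the next neighbour of `v 1`, there is a
crossing-gap. -/
lemma exists_isCrossingGap (h : IsNonHamiltonianPath G v n) {c c' : ℕ} (hc : 1 ≤ c)
    (hcn : c' ≤ n) (hcc' : c < c') (hcy : G.Adj (v c) (v n)) (hcx : G.Adj (v c) (v 1))
    (hcx' : G.Adj (v c') (v 1)) :
    ∃ ij : ℕ × ℕ, IsCrossingGap G v n ij.1 ij.2 ∧ c < ij.1 ∧
      ∀ b, c < b → G.Adj (v b) (v 1) → ij.2 < b := by
  classical
  have hex : ∃ b, c < b ∧ G.Adj (v b) (v 1) := ⟨c', hcc', hcx'⟩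
  set b := Nat.find hex with hb
  obtain ⟨hcb, hbx⟩ := Nat.find_spec hex
  have hbmin : ∀ k, c < k → G.Adj (v k) (v 1) → b ≤ k := fun k hk hkx ↦ Nat.find_min' hex ⟨hk, hkx⟩
  have hbc' := hbmin c' hcc' hcx'
  have hbn : b ≠ n := by
    intro hbn
    rw [← hb, hbn] at hbx
    exact h.not_adj_ends hbx.symm
  set a := Nat.findGreatest (fun k ↦ G.Adj (v k) (v n)) (b - 1) with ha
  have hca : c ≤ a := Nat.le_findGreatest (by lia) hcy
  have hab : a ≤ b - 1 := Nat.findGreatest_le _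
  have hay : G.Adj (v a) (v n) :=
    Nat.findGreatest_spec (P := fun k ↦ G.Adj (v k) (v n)) (m := c) (by lia) hcy
  have hc1 : c ≠ 1 := by rintro rfl; exact G.irrefl hcx
  have hne : a + 1 ≠ b := by
    intro hab'
    refine h.not_adj_succ (by lia) (by lia) hay ?_
    rwa [hab']
  refine ⟨(a + 1, b - 1), ⟨by lia, by lia, by lia, fun k hk hk' ↦ ⟨fun hkx ↦ ?_, fun hky ↦ ?_⟩,
    by simpa using hay, ?_⟩, by lia, fun k hk hkx ↦ ?_⟩
  · have := hbmin k (by lia) hkx; lia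
  · exact Nat.findGreatest_is_greatest (P := fun k ↦ G.Adj (v k) (v n)) (by lia) hk' hky
  · rwa [Nat.sub_add_cancel (by lia)]
  · have := hbmin k hk hkx; lia

theorem card_commonNeighbors_sub_one_le (h : IsNonHamiltonianPath G v n) :
    Nat.card ↥(G.neighborSet (v 1) ∩ G.neighborSet (v n)) - 1 ≤
      Nat.card {ij : ℕ × ℕ | IsCrossingGap G v n ij.1 ij.2} := by
  classical
  set Q := (Finset.Icc 1 n).filter fun k ↦ G.Adj (v k) (v 1) ∧ G.Adj (v k) (v n) with hQ
  have hmem : ∀ {k}, k ∈ Q ↔ (1 ≤ k ∧ k ≤ n) ∧ G.Adj (v k) (v 1) ∧ G.Adj (v k) (v n) := by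
    simp [hQ]
  have hcard : Nat.card ↥(G.neighborSet (v 1) ∩ G.neighborSet (v n)) = Q.card := by
    rw [hQ, h.card_filter_index fun u ↦ G.Adj u (v 1) ∧ G.Adj u (v n), Nat.card_eq_fintype_card,
      ← Set.toFinset_card]
    congr 1
    ext u
    simp [SimpleGraph.adj_comm]
  have hfin : {ij : ℕ × ℕ | IsCrossingGap G v n ij.1 ij.2}.Finite := by
    refine (Set.finite_Icc (0, 0) (n, n)).subset fun ij hij ↦ ?_
    obtain ⟨-, h₁, h₂, -⟩ := hij
    exact ⟨⟨by simp, by simp⟩, ⟨by simp only; lia, by simp only; lia⟩⟩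
  rw [hcard, Nat.card_coe_set_eq]
  rcases Q.eq_empty_or_nonempty with hQe | hQne
  · simp [hQe]
  rw [← Finset.card_erase_of_mem (Q.max'_mem hQne), ← Set.ncard_coe_finset]
  have hgap : ∀ c ∈ Q.erase (Q.max' hQne), ∃ ij : ℕ × ℕ, IsCrossingGap G v n ij.1 ij.2 ∧
      c < ij.1 ∧ ∀ b, c < b → G.Adj (v b) (v 1) → ij.2 < b := by
    intro c hc
    have hlt := Q.lt_max'_of_mem_erase_max' hQne hc
    have hcQ := hmem.mp (Finset.mem_of_mem_erase hc)
    have hmax := hmem.mp (Q.max'_mem hQne)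
    exact h.exists_isCrossingGap hcQ.1.1 hmax.1.2 hlt hcQ.2.2 hcQ.2.1 hmax.2.1
  choose! g hg hcg hgc using hgap
  refine Set.ncard_le_ncard_of_injOn g (fun c hc ↦ hg c hc) (fun c hc c' hc' hcc' ↦ ?_) hfin
  have hlt : ∀ a ∈ Q.erase (Q.max' hQne), ∀ b ∈ Q.erase (Q.max' hQne), g a = g b → ¬ a < b := by
    intro a ha b hb hgab hab
    have h₁ := hgc a ha b hab (hmem.mp (Finset.mem_of_mem_erase hb)).2.1
    have h₂ := hcg b hb
    have h₃ := (hg b hb).2.1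
    rw [hgab] at h₁
    lia
  have h₁ := hlt c hc c' hc' hcc'
  have h₂ := hlt c' hc' c hc hcc'.symm
  lia

end IsNonHamiltonianPath

/-- Let `t ≥ 4` be rational and `G` a `t`-tough non-Hamiltonian graph on `n ≥ 3`
vertices with a Hamilton path `v 1, …, v n` from `x = v 1` to `y = v n`, where
`x ≁ y` and `deg x + deg y ≥ n − t`.  Then there is no crossing-gap consisting of a
single vertex, and if `q ≥ 1` is the number of common neighbors of `x` and `y`,
there are at least `q − 1` distinct crossing-gaps. -/
theorem crossing_gap_size_and_count
    {V : Type*} [Fintype V] [DecidableEq V] (G : SimpleGraph V) [DecidableRel G.Adj]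
    (n : ℕ) (t : ℚ) (ht : 4 ≤ t) (hn : Fintype.card V = n) (hn3 : 3 ≤ n)
    (htough : SimpleGraph.Tough t G) (hnotham : ¬ G.IsHamiltonian)
    (v : ℕ → V) (hbij : Set.BijOn v (Set.Icc 1 n) Set.univ)
    (hpath : ∀ i, 1 ≤ i → i < n → G.Adj (v i) (v (i + 1)))
    (hnadj : ¬ G.Adj (v 1) (v n))
    (hdeg : (n : ℚ) - t ≤ (G.degree (v 1) : ℚ) + (G.degree (v n) : ℚ)) :
    (∀ i, 3 ≤ i → i ≤ n - 2 →
      ¬ (¬ G.Adj (v i) (v 1) ∧ ¬ G.Adj (v i) (v n) ∧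
          G.Adj (v (i - 1)) (v n) ∧ G.Adj (v (i + 1)) (v 1))) ∧
    ∀ q : ℕ, q = Nat.card ↥(G.neighborSet (v 1) ∩ G.neighborSet (v n)) → 1 ≤ q →
      q - 1 ≤ Nat.card {ij : ℕ × ℕ | IsCrossingGap G v n ij.1 ij.2} := by
  have h : IsNonHamiltonianPath G v n := ⟨hn, hn3, hnotham, hbij, hpath, hnadj⟩
  refine ⟨fun i hi hin hgap ↦ h.not_isSingletonGap ht htough hdeg i ⟨hi, hin, hgap⟩, ?_⟩
  rintro q rfl -
  exact h.card_commonNeighbors_sub_one_le
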